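/- Let n≥1 be an integer, c>0, and φ∈C^∞(𝕋,ℝ) with inf_{x∈𝕋}‖R_{2φ(x)}−Id‖ ≥ c/n². Then for every t≥1 there is a constant C(t) depending only on t and c such that |D^t (R_{2φ}−Id)⁻¹|₀ ≤ C(t)·n^{2(t+1)}·‖φ‖_t. -/

import Mathlib

open Real MeasureTheory Filter Finset

attribute [local instance] Matrix.frobeniusNormedAddCommGroup Matrix.frobeniusNormedSpace

/-- The rotation matrix `R_θ` by angle `2πθ`. -/
noncomputable def Rot (θ : ℝ) : Matrix (Fin 2) (Fin 2) ℝ :=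
  !![Real.cos (2*π*θ), -Real.sin (2*π*θ); Real.sin (2*π*θ), Real.cos (2*π*θ)]

/-- `|f|₀ = sup_x ‖f x‖`. -/
noncomputable def C0norm {E : Type*} [NormedAddCommGroup E] (f : ℝ → E) : ℝ := ⨆ x, ‖f x‖

/-- `‖f‖_k = ∑_{h=0}^{k} sup_x ‖D^h f x‖`. -/
noncomputable def Cnorm {E : Type*} [NormedAddCommGroup E] [NormedSpace ℝ E]
    (k : ℕ) (f : ℝ → E) : ℝ :=
  ∑ h ∈ Finset.range (k+1), ⨆ x, ‖iteratedDeriv h f x‖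

/-- `‖x‖ = dist(x, ℤ)`. -/
noncomputable def distToInt (x : ℝ) : ℝ := |x - round x|

/-- `q` is the sequence of denominators of best rational approximations of `α`. -/
def IsBestApproxDenoms (α : ℝ) (q : ℕ → ℕ) : Prop :=
  q 0 = 1 ∧
  (∀ n : ℕ, ∀ k : ℕ, 1 ≤ k → k < q (n+1) → distToInt ((q n : ℝ) * α) ≤ distToInt ((k : ℝ) * α)) ∧
  (∀ n : ℕ, 1 / ((q (n+1) : ℝ) + (q n : ℝ)) < distToInt ((q n : ℝ) * α) ∧
    distToInt ((q n : ℝ) * α) < 1 / (q (n+1) : ℝ))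

/-- The selected subsequence `(n_h)` of Definition 1: `n₀ = 0`; if some `q_k` lies in
`[q_{n_h+1}², q_{n_h+1}⁴)` then `n_{h+1}` is the smallest such `k`, otherwise
`n_{h+1} = max {k : q_k ≤ q_{n_h+1}²}`. -/
def IsSelectedSubseq (q : ℕ → ℕ) (nseq : ℕ → ℕ) : Prop :=
  nseq 0 = 0 ∧ ∀ h : ℕ,
    ((∃ k, (q (nseq h + 1))^2 ≤ q k ∧ q k < (q (nseq h + 1))^4) →
      ((q (nseq h + 1))^2 ≤ q (nseq (h+1)) ∧ q (nseq (h+1)) < (q (nseq h + 1))^4 ∧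
        ∀ k, (q (nseq h + 1))^2 ≤ q k → q k < (q (nseq h + 1))^4 → nseq (h+1) ≤ k)) ∧
    ((¬ ∃ k, (q (nseq h + 1))^2 ≤ q k ∧ q k < (q (nseq h + 1))^4) →
      (q (nseq (h+1)) ≤ (q (nseq h + 1))^2 ∧
        ∀ k, q k ≤ (q (nseq h + 1))^2 → k ≤ nseq (h+1)))

/-- Birkhoff sums `S_m f (x) = ∑_{j<m} f (x + jα)`. -/
noncomputable def birkhoff (α : ℝ) (f : ℝ → ℝ) (m : ℕ) (x : ℝ) : ℝ :=
  ∑ j ∈ Finset.range m, f (x + j * α)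

/-- Iterated cocycle `A^{(m)}(x) = A(x+(m-1)α) ⋯ A(x+α) A(x)`. -/
noncomputable def cocycleIter (α : ℝ) (A : ℝ → Matrix (Fin 2) (Fin 2) ℝ) :
    ℕ → ℝ → Matrix (Fin 2) (Fin 2) ℝ
  | 0, _ => 1
  | (m+1), x => A (x + m * α) * cocycleIter α A m x

/-- The unit vector `(cos 2πy, sin 2πy)`. -/
noncomputable def unitVec (y : ℝ) : Fin 2 → ℝ := ![Real.cos (2*π*y), Real.sin (2*π*y)]

/-- The orbit of the second coordinate under the lift `G̃(x,y) = (x+α, y + f(x,y))`. -/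
noncomputable def liftOrbit (f : ℝ → ℝ → ℝ) (α x y : ℝ) : ℕ → ℝ
  | 0 => y
  | (i+1) => liftOrbit f α x y i + f (x + i * α) (liftOrbit f α x y i)

/-- `ρ` is a representative of the fibered rotation number of the cocycle `(α, A)`:
there is a continuous lift `G̃(x,y) = (x+α, y + f(x,y))` of the projectivized cocycle
(with `f` 1-periodic in both variables) whose Birkhoff averages converge to `ρ`. -/
def IsRotNumRep (α : ℝ) (A : ℝ → Matrix (Fin 2) (Fin 2) ℝ) (ρ : ℝ) : Prop :=
  ∃ f : ℝ → ℝ → ℝ, Continuous (Function.uncurry f) ∧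
    (∀ x y, f (x + 1) y = f x y ∧ f x (y + 1) = f x y) ∧
    (∀ x y, ∃ r : ℝ, 0 < r ∧ (A x).mulVec (unitVec y) = r • unitVec (y + f x y)) ∧
    (∀ x y : ℝ, Tendsto
      (fun n : ℕ => (∑ i ∈ Finset.range n, f (x + i * α) (liftOrbit f α x y i)) / n)
      atTop (nhds ρ))


/-- A Landau inequality on the line: a function bounded by `A` whose second derivative is
bounded by `B` has derivative at most `√(8AB)`. -/
theorem sq_deriv_le_of_abs_le {f : ℝ → ℝ} (hf : Differentiable ℝ f)
    (hf' : Differentiable ℝ (deriv f)) {A B : ℝ} (hA : ∀ x, |f x| ≤ A)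
    (hB : ∀ x, |deriv (deriv f) x| ≤ B) (x : ℝ) : deriv f x ^ 2 ≤ 8 * A * B := by
  have hA0 : 0 ≤ A := (abs_nonneg _).trans (hA 0)
  have hB0 : 0 ≤ B := (abs_nonneg _).trans (hB 0)
  have key : ∀ h : ℝ, 0 ≤ B * (h * h) + (-|deriv f x|) * h + 2 * A := by
    intro h
    rcases le_or_gt h 0 with hh | hh
    · nlinarith [mul_nonneg hB0 (mul_self_nonneg h),
        mul_nonneg (abs_nonneg (deriv f x)) (neg_nonneg.2 hh)]
    obtain ⟨y, hy, hslope⟩ := exists_deriv_eq_slope f (show x < x + h by linarith)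
      hf.continuous.continuousOn hf.differentiableOn
    have hy' : h * deriv f y = f (x + h) - f x := by
      rw [hslope, add_sub_cancel_left, mul_div_cancel₀ _ hh.ne']
    have hlip : |deriv f y - deriv f x| ≤ B * |y - x| := by
      simpa [Real.norm_eq_abs] using
        Convex.norm_image_sub_le_of_norm_deriv_le (s := Set.univ) (fun z _ => hf' z)
          (fun z _ => hB z) convex_univ (Set.mem_univ x) (Set.mem_univ y)
    have hyx : |y - x| ≤ h := by
      rw [abs_le]; constructor <;> linarith [hy.1, hy.2]
    have h1 : h * |deriv f y| ≤ 2 * A := by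
      have h3 : h * |deriv f y| = |f (x + h) - f x| := by rw [← hy', abs_mul, abs_of_pos hh]
      have h4 := norm_sub_le (f (x + h)) (f x)
      simp only [Real.norm_eq_abs] at h4
      linarith [hA (x + h), hA x]
    have h2 : |deriv f x| ≤ |deriv f y| + B * h := by
      have h3 := abs_sub_abs_le_abs_sub (deriv f x) (deriv f y)
      rw [abs_sub_comm] at h3
      linarith [mul_le_mul_of_nonneg_left hyx hB0]
    nlinarith [mul_le_mul_of_nonneg_left h2 hh.le]
  have := discrim_le_zero key
  rw [discrim, neg_sq, sq_abs] at this
  linarith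

/-- If `N` is nonnegative, log-convex and `N 0 ≤ 1`, then `k ↦ N k ^ (1 / k)` is nondecreasing
from each index to the next one. -/
theorem pow_succ_le_pow_of_logConvex {N : ℕ → ℝ} (h0 : ∀ k, 0 ≤ N k) (h1 : N 0 ≤ 1)
    (h : ∀ k, N (k + 1) ^ 2 ≤ N k * N (k + 2)) (k : ℕ) : N k ^ (k + 1) ≤ N (k + 1) ^ k := by
  induction k with
  | zero => simpa using h1
  | succ k ih =>
    rcases (h0 (k + 1)).eq_or_lt with hz | hz
    · rw [← hz, zero_pow (by omega)]
      exact pow_nonneg (h0 _) _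
    · have h2 : N (k + 1) ^ k * N (k + 1) ^ (k + 2) ≤ N (k + 1) ^ k * N (k + 2) ^ (k + 1) := by
        calc N (k + 1) ^ k * N (k + 1) ^ (k + 2) = (N (k + 1) ^ 2) ^ (k + 1) := by ring
          _ ≤ (N k * N (k + 2)) ^ (k + 1) := by gcongr; exact h k
          _ = N k ^ (k + 1) * N (k + 2) ^ (k + 1) := by ring
          _ ≤ _ := mul_le_mul_of_nonneg_right ih (pow_nonneg (h0 _) _)
      exact le_of_mul_le_mul_left h2 (pow_pos hz k)

theorem rpow_inv_le_rpow_inv_of_logConvex {N : ℕ → ℝ} (h0 : ∀ k, 0 ≤ N k) (h1 : N 0 ≤ 1)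
    (h : ∀ k, N (k + 1) ^ 2 ≤ N k * N (k + 2)) {i t : ℕ} (hi : 1 ≤ i) (hit : i ≤ t) :
    N i ^ ((i : ℝ)⁻¹) ≤ N t ^ ((t : ℝ)⁻¹) := by
  induction t, hit using Nat.le_induction with
  | base => rfl
  | succ t hit ih =>
    refine ih.trans ?_
    have ht : (t : ℝ) ≠ 0 := by
      have : 0 < t := by omega
      positivity
    have ht1 : ((t + 1 : ℕ) : ℝ) ≠ 0 := by positivity
    have h2 := Real.rpow_le_rpow (pow_nonneg (h0 t) _) (pow_succ_le_pow_of_logConvex h0 h1 h t)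
      (show 0 ≤ (t : ℝ)⁻¹ * ((t + 1 : ℕ) : ℝ)⁻¹ by positivity)
    rw [← Real.rpow_natCast, ← Real.rpow_natCast, ← Real.rpow_mul (h0 _),
      ← Real.rpow_mul (h0 _)] at h2
    rwa [mul_left_comm, mul_inv_cancel₀ ht1, mul_one, mul_inv_cancel_left₀ ht] at h2

theorem bddAbove_range_norm_iteratedDeriv_of_periodic {f : ℝ → ℝ} (hf : ContDiff ℝ (⊤ : ℕ∞) f)
    (hp : Function.Periodic f 1) (k : ℕ) :
    BddAbove (Set.range fun x => ‖iteratedDeriv k f x‖) := by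
  have hper : Function.Periodic (iteratedDeriv k f) 1 := by
    intro x
    have := congrFun (iteratedDeriv_comp_add_const k f 1) x
    rw [← this]
    congr 1
    exact funext hp
  have hc : Continuous (iteratedDeriv k f) :=
    hf.continuous_iteratedDeriv k (by exact_mod_cast le_top)
  exact (Function.Periodic.compact_of_continuous (f := fun x => ‖iteratedDeriv k f x‖)
    (fun x => by simp only [hper x]) one_ne_zero hc.norm).bddAbove

theorem sq_iSup_norm_iteratedDeriv_le {f : ℝ → ℝ} (hf : ContDiff ℝ (⊤ : ℕ∞) f)
    (hp : Function.Periodic f 1) (k : ℕ) :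
    (⨆ x, ‖iteratedDeriv (k + 1) f x‖) ^ 2 ≤
      8 * (⨆ x, ‖iteratedDeriv k f x‖) * ⨆ x, ‖iteratedDeriv (k + 2) f x‖ := by
  have hbdd := bddAbove_range_norm_iteratedDeriv_of_periodic hf hp
  have hdiff : ∀ j, Differentiable ℝ (iteratedDeriv j f) := fun j =>
    hf.differentiable_iteratedDeriv j (by exact_mod_cast WithTop.coe_lt_top j)
  have hnn : ∀ j, 0 ≤ ⨆ x, ‖iteratedDeriv j f x‖ := fun j =>
    Real.iSup_nonneg fun x => norm_nonneg _
  have hpt := sq_deriv_le_of_abs_le (hdiff k) (by rw [← iteratedDeriv_succ]; exact hdiff (k + 1))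
    (fun x => le_ciSup (hbdd k) x)
    (B := ⨆ x, ‖iteratedDeriv (k + 2) f x‖)
    (fun x => by
      rw [← iteratedDeriv_succ, ← iteratedDeriv_succ]
      exact le_ciSup (hbdd (k + 2)) x)
  have hle : (⨆ x, ‖iteratedDeriv (k + 1) f x‖) ≤ √(8 * (⨆ x, ‖iteratedDeriv k f x‖) *
      ⨆ x, ‖iteratedDeriv (k + 2) f x‖) := ciSup_le fun x => by
    rw [iteratedDeriv_succ]
    exact Real.abs_le_sqrt (hpt x)
  exact (Real.le_sqrt (hnn _) (by have := hnn k; have := hnn (k + 2); positivity)).1 hle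

/-- Interpolation of the intermediate derivatives of a periodic function of oscillation at
most one. -/
theorem norm_iteratedDeriv_le_rpow {φ : ℝ → ℝ} (hφ : ContDiff ℝ (⊤ : ℕ∞) φ)
    (hp : Function.Periodic φ 1) (hosc : ∀ x, |φ x - φ 0| ≤ 1) {i t : ℕ} (hi : 1 ≤ i)
    (hit : i ≤ t) (x : ℝ) :
    ‖iteratedDeriv i φ x‖ ≤
      ((2 ^ (2 * t ^ 2) * ⨆ x, ‖iteratedDeriv t φ x‖) ^ ((t : ℝ)⁻¹)) ^ i := by
  set ψ : ℝ → ℝ := fun x => -φ 0 + φ x with hψ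
  have hψs : ContDiff ℝ (⊤ : ℕ∞) ψ := contDiff_const.add hφ
  have hψp : Function.Periodic ψ 1 := fun x => by simp only [hψ, hp x]
  have heq : ∀ j, 1 ≤ j → iteratedDeriv j ψ = iteratedDeriv j φ := fun j hj =>
    funext fun x => iteratedDeriv_const_add hj _
  set N : ℕ → ℝ := fun k => 2 ^ (2 * k ^ 2) * ⨆ x, ‖iteratedDeriv k ψ x‖ with hN
  have hnn : ∀ j, 0 ≤ ⨆ x, ‖iteratedDeriv j ψ x‖ := fun j =>
    Real.iSup_nonneg fun x => norm_nonneg _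
  have hN0 : ∀ k, 0 ≤ N k := fun k => mul_nonneg (by positivity) (hnn k)
  have hN1 : N 0 ≤ 1 := by
    simp only [hN, iteratedDeriv_zero]
    norm_num
    refine ciSup_le fun x => ?_
    simpa [hψ, neg_add_eq_sub] using hosc x
  have hconv : ∀ k, N (k + 1) ^ 2 ≤ N k * N (k + 2) := by
    intro k
    have h := sq_iSup_norm_iteratedDeriv_le hψs hψp k
    simp only [hN]
    have hpos : (0 : ℝ) < 2 ^ (4 * (k + 1) ^ 2) := by positivity
    have h1 : (2 : ℝ) ^ (2 * k ^ 2) * 2 ^ (2 * (k + 2) ^ 2) = 16 * 2 ^ (4 * (k + 1) ^ 2) := by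
      rw [show (16 : ℝ) = 2 ^ 4 by norm_num, ← pow_add, ← pow_add]
      congr 1; ring
    rw [mul_pow, ← pow_mul, show 2 * (k + 1) ^ 2 * 2 = 4 * (k + 1) ^ 2 by ring,
      mul_mul_mul_comm, h1]
    nlinarith [mul_le_mul_of_nonneg_left h hpos.le,
      mul_nonneg hpos.le (mul_nonneg (hnn k) (hnn (k + 2)))]
  have hmono := rpow_inv_le_rpow_inv_of_logConvex hN0 hN1 hconv hi hit
  rw [← heq i hi, ← heq t (hi.trans hit)]
  calc ‖iteratedDeriv i ψ x‖ ≤ ⨆ x, ‖iteratedDeriv i ψ x‖ :=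
        le_ciSup (bddAbove_range_norm_iteratedDeriv_of_periodic hψs hψp i) x
    _ ≤ N i := le_mul_of_one_le_left (hnn i) (one_le_pow₀ (by norm_num))
    _ = (N i ^ ((i : ℝ)⁻¹)) ^ i := (Real.rpow_inv_natCast_pow (hN0 i) (by omega)).symm
    _ ≤ _ := by
      gcongr
      exact Real.rpow_nonneg (hN0 i) _

theorem exists_iteratedDeriv_cot_eq (j : ℕ) : ∃ q : Polynomial ℝ, ∀ θ : ℝ, sin (2 * π * θ) ≠ 0 →
    iteratedDeriv j (fun θ : ℝ => cos (2 * π * θ) / sin (2 * π * θ)) θ =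
      q.eval (cos (2 * π * θ)) / sin (2 * π * θ) ^ (j + 1) := by
  induction j with
  | zero => exact ⟨Polynomial.X, fun θ _ => by simp⟩
  | succ j ih =>
    obtain ⟨q, hq⟩ := ih
    refine ⟨Polynomial.C (-(2 * π)) * ((1 - Polynomial.X ^ 2) * Polynomial.derivative q +
      (j + 1 : Polynomial ℝ) * Polynomial.X * q), fun θ hθ => ?_⟩
    rw [iteratedDeriv_succ]
    have hopen : IsOpen {θ : ℝ | sin (2 * π * θ) ≠ 0} :=
      isOpen_ne_fun (by fun_prop) continuous_const
    have hev := (hopen.eventually_mem hθ).mono fun y hy => hq y hy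
    rw [Filter.EventuallyEq.deriv_eq hev]
    have hlin : HasDerivAt (fun θ : ℝ => 2 * π * θ) (2 * π) θ := by
      simpa using (hasDerivAt_id θ).const_mul (2 * π)
    have hd := ((q.hasDerivAt (cos (2 * π * θ))).comp θ hlin.cos).div
      (hlin.sin.pow (j + 1)) (pow_ne_zero _ hθ)
    refine hd.deriv.trans ?_
    have hs := Real.sin_sq_add_cos_sq (2 * π * θ)
    have hs' : 1 - cos (2 * π * θ) ^ 2 = sin (2 * π * θ) ^ 2 := by linarith
    simp only [Polynomial.eval_mul, Polynomial.eval_add, Polynomial.eval_sub, Polynomial.eval_pow,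
      Polynomial.eval_X, Polynomial.eval_C, Polynomial.eval_one, Polynomial.eval_natCast, hs',
      Function.comp, Pi.pow_apply]
    field_simp
    push_cast
    ring

theorem exists_abs_iteratedDeriv_cot_le (j : ℕ) : ∃ B : ℝ, 0 ≤ B ∧ ∀ θ : ℝ, sin (2 * π * θ) ≠ 0 →
    |iteratedDeriv j (fun θ : ℝ => cos (2 * π * θ) / sin (2 * π * θ)) θ| ≤
      B * |sin (2 * π * θ)|⁻¹ ^ (j + 1) := by
  obtain ⟨q, hq⟩ := exists_iteratedDeriv_cot_eq j
  obtain ⟨B, hB⟩ := (isCompact_Icc (a := (-1 : ℝ)) (b := 1)).exists_bound_of_continuousOn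
    q.continuous.continuousOn
  refine ⟨B, (norm_nonneg _).trans (hB 0 (by simp)), fun θ hθ => ?_⟩
  rw [hq θ hθ, abs_div, abs_pow, div_eq_mul_inv, inv_pow]
  gcongr
  exact hB _ ⟨neg_one_le_cos _, cos_le_one _⟩

theorem norm_Rot_sub_one_le (θ : ℝ) : ‖Rot (2 * θ) - 1‖ ≤ 4 * |sin (2 * π * θ)| := by
  rw [Matrix.frobenius_norm_def, ← Real.sqrt_eq_rpow]
  refine Real.sqrt_le_iff.2 ⟨by positivity, ?_⟩
  rw [mul_pow, sq_abs]
  have h1 : 2 * π * (2 * θ) = 2 * (2 * π * θ) := by ring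
  simp only [Fin.sum_univ_two, Rot, h1, Matrix.sub_apply, Real.norm_eq_abs, Real.rpow_two, sq_abs]
  simp [Real.sin_two_mul, Real.cos_two_mul]
  have hs := Real.sin_sq_add_cos_sq (2 * π * θ)
  have hc : cos (2 * π * θ) ^ 2 = 1 - sin (2 * π * θ) ^ 2 := by linarith
  rw [mul_pow, mul_pow, hc]
  nlinarith [sq_nonneg (sin (2 * π * θ))]

theorem inv_Rot_sub_one {θ : ℝ} (h : sin (2 * π * θ) ≠ 0) :
    (Rot (2 * θ) - 1)⁻¹ = (-(1 / 2 : ℝ)) • (1 : Matrix (Fin 2) (Fin 2) ℝ) +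
      (cos (2 * π * θ) / sin (2 * π * θ)) • !![0, 1 / 2; -1 / 2, 0] := by
  apply Matrix.inv_eq_right_inv
  have h1 : 2 * π * (2 * θ) = 2 * (2 * π * θ) := by ring
  have hs := Real.sin_sq_add_cos_sq (2 * π * θ)
  ext i j
  fin_cases i <;> fin_cases j <;>
    simp [Rot, h1, Matrix.mul_apply, Fin.sum_univ_two, Real.sin_two_mul, Real.cos_two_mul] <;>
    field_simp <;>
    first
    | ring1
    | linear_combination (2 * cos (2 * π * θ)) * hs
    | linear_combination (-2 * cos (2 * π * θ)) * hs

/-- A continuous function on the line that avoids the integers has oscillation at most one. -/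
theorem abs_sub_le_one_of_ne_intCast {φ : ℝ → ℝ} (hφ : Continuous φ)
    (h : ∀ x (m : ℤ), φ x ≠ m) (x y : ℝ) : |φ x - φ y| ≤ 1 := by
  have key : ∀ x y, φ x - φ y ≤ 1 := by
    intro x y
    by_contra! hlt
    obtain ⟨z, hz⟩ := mem_range_of_exists_le_of_exists_ge (c := (⌈φ y⌉ : ℝ)) hφ
      ⟨y, Int.le_ceil _⟩ ⟨x, by linarith [Int.ceil_lt_add_one (φ y)]⟩
    exact h z _ hz
  exact abs_le.2 ⟨by linarith [key y x], key x y⟩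

/-- Chain-rule estimate for `cot (2πφ)` when `sin (2πφ)` is bounded away from zero. -/
theorem norm_iteratedDeriv_cot_comp_le {φ : ℝ → ℝ} (hφ : ContDiff ℝ (⊤ : ℕ∞) φ)
    (hp : Function.Periodic φ 1) (hs : ∀ x, sin (2 * π * φ x) ≠ 0) {t : ℕ} (ht : 1 ≤ t) {C : ℝ}
    (hC : ∀ i ≤ t, ∀ x,
      |iteratedDeriv i (fun θ : ℝ => cos (2 * π * θ) / sin (2 * π * θ)) (φ x)| ≤ C) (x : ℝ) :
    ‖iteratedDeriv t (fun y => cos (2 * π * φ y) / sin (2 * π * φ y)) x‖ ≤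
      t.factorial * C * (2 ^ (2 * t ^ 2) * ⨆ x, ‖iteratedDeriv t φ x‖) := by
  have hosc : ∀ x, |φ x - φ 0| ≤ 1 := fun x => by
    refine abs_sub_le_one_of_ne_intCast hφ.continuous (fun x m hm => hs x ?_) x 0
    rw [hm, Real.sin_eq_zero_iff]
    exact ⟨2 * m, by push_cast; ring⟩
  set s : Set ℝ := {θ : ℝ | sin (2 * π * θ) ≠ 0}
  have hopen : IsOpen s := isOpen_ne_fun (by fun_prop) continuous_const
  have hg : ContDiffOn ℝ (⊤ : ℕ∞) (fun θ : ℝ => cos (2 * π * θ) / sin (2 * π * θ)) s :=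
    ContDiffOn.div (ContDiff.contDiffOn (by fun_prop)) (ContDiff.contDiffOn (by fun_prop))
      fun _ h => h
  have hM : 0 ≤ ⨆ x, ‖iteratedDeriv t φ x‖ := Real.iSup_nonneg fun x => norm_nonneg _
  have := norm_iteratedFDeriv_comp_le' (n := t) (Set.range_subset_iff.2 hs) hopen.uniqueDiffOn
    hg hφ (by exact_mod_cast le_top) x (C := C)
    (D := (2 ^ (2 * t ^ 2) * ⨆ x, ‖iteratedDeriv t φ x‖) ^ ((t : ℝ)⁻¹))
    (fun i hi => by
      rw [norm_iteratedFDerivWithin_eq_norm_iteratedDerivWithin,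
        iteratedDerivWithin_of_isOpen hopen (hs x)]
      exact hC i hi x)
    (fun i hi hit => by
      rw [norm_iteratedFDeriv_eq_norm_iteratedDeriv]
      exact norm_iteratedDeriv_le_rpow hφ hp hosc hi hit x)
  rwa [Real.rpow_inv_natCast_pow (by positivity) (by omega),
    norm_iteratedFDeriv_eq_norm_iteratedDeriv] at this

/-- Lemma 7: bound on the derivatives of `(R_{2φ} − Id)⁻¹`. -/
theorem statement7 (c : ℝ) (hc : 0 < c) :
    ∃ C : ℕ → ℝ, (∀ t, 0 < C t) ∧
    ∀ n : ℕ, 1 ≤ n → ∀ φ : ℝ → ℝ,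
      ContDiff ℝ (⊤ : ℕ∞) φ → Function.Periodic φ 1 →
      (∀ x, c / (n:ℝ)^2 ≤ ‖Rot (2 * φ x) - 1‖) →
      ∀ t : ℕ, 1 ≤ t →
        (⨆ x : ℝ, ‖iteratedDeriv t (fun y => (Rot (2 * φ y) - 1)⁻¹) x‖) ≤
          C t * (n:ℝ)^(2*(t+1)) * Cnorm t φ := by
  choose B hB0 hB using exists_abs_iteratedDeriv_cot_le
  set K : ℝ := max 1 (4 / c)
  set J : Matrix (Fin 2) (Fin 2) ℝ := !![0, 1 / 2; -1 / 2, 0]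
  have hK1 : 1 ≤ K := le_max_left _ _
  have hBs : ∀ t, 0 ≤ ∑ j ∈ Finset.range (t + 1), B j := fun t =>
    Finset.sum_nonneg fun j _ => hB0 j
  refine ⟨fun t => t.factorial * ((∑ j ∈ Finset.range (t + 1), B j) * K ^ (t + 1)) *
    2 ^ (2 * t ^ 2) * ‖J‖ + 1, fun t => by have := hBs t; positivity, ?_⟩
  intro n hn φ hφ hp hlow t ht
  have hn1 : (1 : ℝ) ≤ n := by exact_mod_cast hn
  have hlow' : ∀ x, c / (n : ℝ) ^ 2 ≤ 4 * |sin (2 * π * φ x)| := fun x =>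
    (hlow x).trans (norm_Rot_sub_one_le _)
  have hs : ∀ x, sin (2 * π * φ x) ≠ 0 := fun x => by
    have h1 : 0 < c / (n : ℝ) ^ 2 := by positivity
    exact abs_pos.1 (by linarith [hlow' x])
  have hinv : ∀ x, |sin (2 * π * φ x)|⁻¹ ≤ K * (n : ℝ) ^ 2 := fun x => by
    have h1 : |sin (2 * π * φ x)|⁻¹ ≤ (c / (n : ℝ) ^ 2 / 4)⁻¹ := by
      apply inv_anti₀ (by positivity)
      linarith [hlow' x]
    refine h1.trans ?_
    rw [show (c / (n : ℝ) ^ 2 / 4)⁻¹ = 4 / c * (n : ℝ) ^ 2 by field_simp]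
    gcongr
    exact le_max_right _ _
  have hKn : 1 ≤ K * (n : ℝ) ^ 2 := one_le_mul_of_one_le_of_one_le hK1 (one_le_pow₀ hn1)
  have hcot : ∀ i ≤ t, ∀ x,
      |iteratedDeriv i (fun θ : ℝ => cos (2 * π * θ) / sin (2 * π * θ)) (φ x)| ≤
        (∑ j ∈ Finset.range (t + 1), B j) * (K * (n : ℝ) ^ 2) ^ (t + 1) := fun i hi x => by
    refine (hB i (φ x) (hs x)).trans ?_
    refine mul_le_mul ?_ ?_ (by positivity) (hBs t)
    · exact Finset.single_le_sum (fun j _ => hB0 j) (Finset.mem_range.2 (by omega))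
    · exact (pow_le_pow_left₀ (by positivity) (hinv x) _).trans
        (pow_le_pow_right₀ hKn (by omega))
  have hM : 0 ≤ ⨆ x, ‖iteratedDeriv t φ x‖ := Real.iSup_nonneg fun x => norm_nonneg _
  have hMC : (⨆ x, ‖iteratedDeriv t φ x‖) ≤ Cnorm t φ :=
    Finset.single_le_sum (f := fun h => ⨆ x, ‖iteratedDeriv h φ x‖)
      (fun j _ => Real.iSup_nonneg fun x => norm_nonneg _) (Finset.mem_range.2 (Nat.lt_succ_self t))
  have hu : ContDiff ℝ (⊤ : ℕ∞) fun y => cos (2 * π * φ y) / sin (2 * π * φ y) :=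
    ContDiff.div (by fun_prop) (by fun_prop) hs
  refine ciSup_le fun x => ?_
  have hfun : (fun y => (Rot (2 * φ y) - 1)⁻¹) = fun y =>
      (-(1 / 2 : ℝ)) • (1 : Matrix (Fin 2) (Fin 2) ℝ) +
        (cos (2 * π * φ y) / sin (2 * π * φ y)) • J := funext fun y => inv_Rot_sub_one (hs y)
  rw [hfun, iteratedDeriv_const_add (by omega),
    iteratedDeriv_smul_const (hu.contDiffAt.of_le (by exact_mod_cast le_top)), norm_smul]
  calc _ ≤ t.factorial * ((∑ j ∈ Finset.range (t + 1), B j) * (K * (n : ℝ) ^ 2) ^ (t + 1)) *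
        (2 ^ (2 * t ^ 2) * ⨆ x, ‖iteratedDeriv t φ x‖) * ‖J‖ := by
        gcongr
        exact norm_iteratedDeriv_cot_comp_le hφ hp hs ht hcot x
    _ = t.factorial * ((∑ j ∈ Finset.range (t + 1), B j) * K ^ (t + 1)) *
        2 ^ (2 * t ^ 2) * ‖J‖ * (n : ℝ) ^ (2 * (t + 1)) * ⨆ x, ‖iteratedDeriv t φ x‖ := by
        rw [mul_pow, ← pow_mul]; ring
    _ ≤ _ := by
        have := hBs t
        gcongr
        exact le_add_of_nonneg_right zero_le_one
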